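/- Let |α| < 1, c > 0, γ = 2σ_Y²( c/(1+α) + 1/(1−α) ), and σ_{Z1}² = γσ1²/(γ + σ1²). Let θ̂ : ℝ^{2p} → ℝ^p be measurable, and let Z = (Z1, Z2) with Z1 ~ N_p(θ1, σ_{Z1}² I_p), Z2 ~ N_p(θ2, σ2² I_p) independent. If for every θ with θ1 − θ2 ∈ A one has E‖θ̂(Z) − θ1‖² ≤ E‖Z1 − θ1‖², with strict inequality for at least one such θ, then the predictive density q_{θ̂,c} dominates q_{X1,c} (the density N_p(X1, cσ_Y² I_p)) under the α-divergence risk R_α over the restricted parameter space {θ : θ1 − θ2 ∈ A}. -/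

import Mathlib

open MeasureTheory Real Set

noncomputable section

abbrev Ep (p : ℕ) := EuclideanSpace ℝ (Fin p)

/-- Density of `N_p(0, v I_p)` evaluated at `u`. -/
def gdens (p : ℕ) (v : ℝ) (u : Ep p) : ℝ :=
  (2 * Real.pi * v) ^ (-(p : ℝ) / 2) * Real.exp (-‖u‖ ^ 2 / (2 * v))

/-- Joint density of a pair of independent Gaussians. -/
def jointDens (p : ℕ) (v1 v2 : ℝ) (θ1 θ2 : Ep p) (x : Ep p × Ep p) : ℝ :=
  gdens p v1 (x.1 - θ1) * gdens p v2 (x.2 - θ2)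

/-- α-divergence risk (|α| < 1) of a predictive density estimator. -/
def aRisk (p : ℕ) (α σ12 σ22 σY2 : ℝ) (θ1 θ2 : Ep p)
    (qhat : Ep p × Ep p → Ep p → ℝ) : ℝ :=
  ∫ x : Ep p × Ep p,
    (4 / (1 - α ^ 2)) *
      (1 - ∫ y : Ep p, (qhat x y) ^ ((1 + α) / 2) *
        (gdens p σY2 (y - θ1)) ^ ((1 - α) / 2)) *
    jointDens p σ12 σ22 θ1 θ2 x

lemma integrable_exp_neg_mul_norm_sq (p : ℕ) {b : ℝ} (hb : 0 < b) :
    Integrable (fun u : Ep p => Real.exp (-b * ‖u‖ ^ 2)) := by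
  have h := (GaussianFourier.integrable_cexp_neg_mul_sq_norm_add (V := Ep p) (b := (b : ℂ))
    (by simpa using hb) 0 0).norm
  refine h.congr (Filter.Eventually.of_forall fun u => ?_)
  simp [Complex.norm_exp, ← Complex.ofReal_pow]

lemma integrable_norm_sq_mul_exp_neg_mul_norm_sq (p : ℕ) {b : ℝ} (hb : 0 < b) :
    Integrable (fun u : Ep p => ‖u‖ ^ 2 * Real.exp (-b * ‖u‖ ^ 2)) := by
  refine ((integrable_exp_neg_mul_norm_sq p (half_pos hb)).const_mul (2 / b)).mono'
    (by fun_prop) (Filter.Eventually.of_forall fun u => ?_)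
  rw [Real.norm_of_nonneg (by positivity)]
  have hsplit : Real.exp (-(b / 2) * ‖u‖ ^ 2)
      = Real.exp (b / 2 * ‖u‖ ^ 2) * Real.exp (-b * ‖u‖ ^ 2) := by
    rw [← Real.exp_add]; ring_nf
  rw [hsplit, ← mul_assoc]
  refine mul_le_mul_of_nonneg_right ?_ (Real.exp_pos _).le
  have hle := Real.add_one_le_exp (b / 2 * ‖u‖ ^ 2)
  calc ‖u‖ ^ 2 = 2 / b * (b / 2 * ‖u‖ ^ 2) := by field_simp
    _ ≤ _ := mul_le_mul_of_nonneg_left (by linarith) (by positivity)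

lemma gdens_eq_exp_neg_mul (p : ℕ) (v : ℝ) (u : Ep p) :
    gdens p v u =
      (2 * Real.pi * v) ^ (-(p : ℝ) / 2) * Real.exp (-(1 / (2 * v)) * ‖u‖ ^ 2) := by
  unfold gdens
  congr 2
  ring

lemma integrable_gdens (p : ℕ) {v : ℝ} (hv : 0 < v) : Integrable (gdens p v) := by
  simp_rw [funext (gdens_eq_exp_neg_mul p v)]
  exact (integrable_exp_neg_mul_norm_sq p (by positivity)).const_mul _

lemma integrable_norm_sq_mul_gdens (p : ℕ) {v : ℝ} (hv : 0 < v) :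
    Integrable (fun u : Ep p => ‖u‖ ^ 2 * gdens p v u) := by
  simp_rw [gdens_eq_exp_neg_mul p v, mul_left_comm (‖_‖ ^ 2)]
  exact (integrable_norm_sq_mul_exp_neg_mul_norm_sq p (by positivity)).const_mul _

lemma integrable_jointDens (p : ℕ) {v1 v2 : ℝ} (h1 : 0 < v1) (h2 : 0 < v2) (θ1 θ2 : Ep p) :
    Integrable (jointDens p v1 v2 θ1 θ2) :=
  ((integrable_gdens p h1).comp_sub_right θ1).mul_prod ((integrable_gdens p h2).comp_sub_right θ2)

lemma integrable_norm_sq_mul_jointDens (p : ℕ) {v1 v2 : ℝ} (h1 : 0 < v1) (h2 : 0 < v2)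
    (θ1 θ2 : Ep p) :
    Integrable (fun z : Ep p × Ep p => ‖z.1 - θ1‖ ^ 2 * jointDens p v1 v2 θ1 θ2 z) := by
  have h := ((integrable_norm_sq_mul_gdens p h1).comp_sub_right θ1).mul_prod
    ((integrable_gdens p h2).comp_sub_right θ2)
  simp only [mul_assoc] at h
  exact h

lemma jointDens_nonneg (p : ℕ) {v1 v2 : ℝ} (h1 : 0 < v1) (h2 : 0 < v2) (θ1 θ2 : Ep p)
    (x : Ep p × Ep p) : 0 ≤ jointDens p v1 v2 θ1 θ2 x := by
  unfold jointDens gdens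
  positivity

lemma weighted_norm_sq_sub_add (p : ℕ) {a b : ℝ} (ha : 0 < a) (hb : 0 < b) (t θ y : Ep p) :
    a * ‖y - t‖ ^ 2 + b * ‖y - θ‖ ^ 2 =
      (a + b) * ‖y - (θ + (a / (a + b)) • (t - θ))‖ ^ 2 + a * b / (a + b) * ‖t - θ‖ ^ 2 := by
  have hy : y - t = (y - θ) - (t - θ) := by abel
  have hm : y - (θ + (a / (a + b)) • (t - θ)) = (y - θ) - (a / (a + b)) • (t - θ) := by abel
  rw [hy, hm, norm_sub_sq_real (y - θ) (t - θ), norm_sub_sq_real (y - θ), norm_smul, mul_pow, inner_smul_right,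
    Real.norm_eq_abs, sq_abs]
  field_simp
  ring

lemma integral_exp_neg_weighted_norm_sq (p : ℕ) {a b : ℝ} (ha : 0 < a) (hb : 0 < b)
    (t θ : Ep p) :
    ∫ y : Ep p, Real.exp (-(a * ‖y - t‖ ^ 2 + b * ‖y - θ‖ ^ 2)) =
      (Real.pi / (a + b)) ^ ((p : ℝ) / 2) * Real.exp (-(a * b / (a + b)) * ‖t - θ‖ ^ 2) := by
  simp_rw [weighted_norm_sq_sub_add p ha hb t θ, neg_add, Real.exp_add, ← neg_mul]
  rw [integral_mul_const,
    integral_sub_right_eq_self (fun y : Ep p => Real.exp (-(a + b) * ‖y‖ ^ 2)),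
    GaussianFourier.integral_rexp_neg_mul_sq_norm (add_pos ha hb), finrank_euclideanSpace_fin]

lemma gdens_rpow (p : ℕ) {v : ℝ} (hv : 0 < v) (u : Ep p) (s : ℝ) :
    gdens p v u ^ s =
      ((2 * Real.pi * v) ^ (-(p : ℝ) / 2)) ^ s * Real.exp (-(s / (2 * v) * ‖u‖ ^ 2)) := by
  rw [gdens, Real.mul_rpow (by positivity) (Real.exp_pos _).le, ← Real.exp_mul]
  congr 2
  ring

lemma exists_integral_gdens_rpow_mul_gdens_rpow (p : ℕ) {v w s r : ℝ} (hv : 0 < v) (hw : 0 < w)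
    (hs : 0 < s) (hr : 0 < r) :
    ∃ K : ℝ, 0 < K ∧ ∀ t θ : Ep p,
      ∫ y : Ep p, gdens p v (y - t) ^ s * gdens p w (y - θ) ^ r =
        K * Real.exp (-(‖t - θ‖ ^ 2 / (2 * (v / s + w / r)))) := by
  refine ⟨((2 * Real.pi * v) ^ (-(p : ℝ) / 2)) ^ s * ((2 * Real.pi * w) ^ (-(p : ℝ) / 2)) ^ r *
    (Real.pi / (s / (2 * v) + r / (2 * w))) ^ ((p : ℝ) / 2), by positivity, fun t θ => ?_⟩
  simp_rw [gdens_rpow p hv, gdens_rpow p hw, mul_mul_mul_comm, ← Real.exp_add, ← neg_add]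
  rw [integral_const_mul, integral_exp_neg_weighted_norm_sq p (by positivity) (by positivity),
    ← mul_assoc]
  congr 2
  field_simp
  ring

lemma exists_exp_mul_jointDens (p : ℕ) {v1 v2 γ : ℝ} (h1 : 0 < v1) (hγ : 0 < γ) :
    ∃ D : ℝ, 0 < D ∧ ∀ (θ1 θ2 : Ep p) (x : Ep p × Ep p),
      Real.exp (-(‖x.1 - θ1‖ ^ 2 / (2 * γ))) * jointDens p v1 v2 θ1 θ2 x =
        D * jointDens p (γ * v1 / (γ + v1)) v2 θ1 θ2 x := by
  have hpos : 0 < (2 * Real.pi * (γ * v1 / (γ + v1))) ^ (-(p : ℝ) / 2) := by positivity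
  refine ⟨(2 * Real.pi * v1) ^ (-(p : ℝ) / 2) /
    (2 * Real.pi * (γ * v1 / (γ + v1))) ^ (-(p : ℝ) / 2), by positivity, fun θ1 θ2 x => ?_⟩
  have hexp : Real.exp (-‖x.1 - θ1‖ ^ 2 / (2 * (γ * v1 / (γ + v1)))) =
      Real.exp (-(‖x.1 - θ1‖ ^ 2 / (2 * γ))) * Real.exp (-‖x.1 - θ1‖ ^ 2 / (2 * v1)) := by
    rw [← Real.exp_add]
    congr 1
    field_simp
    ring
  unfold jointDens
  rw [gdens, gdens.eq_def p (γ * v1 / (γ + v1)), hexp]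
  field_simp

lemma integrable_exp_neg_mul_jointDens (p : ℕ) {v1 v2 γ : ℝ} (h1 : 0 < v1) (h2 : 0 < v2)
    (hγ : 0 < γ) (θ1 θ2 : Ep p) {T : Ep p × Ep p → Ep p} (hT : Measurable T) :
    Integrable (fun x => Real.exp (-(‖T x - θ1‖ ^ 2 / (2 * γ))) * jointDens p v1 v2 θ1 θ2 x) := by
  refine (integrable_jointDens p h1 h2 θ1 θ2).bdd_mul (c := 1) (by fun_prop)
    (Filter.Eventually.of_forall fun x => ?_)
  rw [Real.norm_of_nonneg (Real.exp_pos _).le, Real.exp_le_one_iff, neg_nonpos]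
  positivity

/-- The reduction in Gaussian-kernel loss from using `T` instead of the first coordinate is at
least a positive multiple of the reduction in squared-error risk in the model with shrunken
variance. -/
lemma exists_mul_sq_risk_sub_le (p : ℕ) {v1 v2 γ : ℝ} (h1 : 0 < v1) (h2 : 0 < v2) (hγ : 0 < γ) :
    ∃ D : ℝ, 0 < D ∧ ∀ (θ1 θ2 : Ep p) (T : Ep p × Ep p → Ep p), Measurable T →
      Integrable (fun z => ‖T z - θ1‖ ^ 2 * jointDens p (γ * v1 / (γ + v1)) v2 θ1 θ2 z) →
      D * ((∫ z, ‖z.1 - θ1‖ ^ 2 * jointDens p (γ * v1 / (γ + v1)) v2 θ1 θ2 z) -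
          ∫ z, ‖T z - θ1‖ ^ 2 * jointDens p (γ * v1 / (γ + v1)) v2 θ1 θ2 z) ≤
        (∫ x, Real.exp (-(‖T x - θ1‖ ^ 2 / (2 * γ))) * jointDens p v1 v2 θ1 θ2 x) -
          ∫ x, Real.exp (-(‖x.1 - θ1‖ ^ 2 / (2 * γ))) * jointDens p v1 v2 θ1 θ2 x := by
  obtain ⟨D, hD, hDeq⟩ := exists_exp_mul_jointDens p (v2 := v2) h1 hγ
  refine ⟨D / (2 * γ), by positivity, fun θ1 θ2 T hT hTint => ?_⟩
  have hZint := integrable_norm_sq_mul_jointDens p (v1 := γ * v1 / (γ + v1)) (by positivity) h2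
    θ1 θ2
  have hTexp := integrable_exp_neg_mul_jointDens p h1 h2 hγ θ1 θ2 hT
  have hXexp := integrable_exp_neg_mul_jointDens p h1 h2 hγ θ1 θ2 measurable_fst
  rw [← integral_sub hZint hTint, ← integral_sub hTexp hXexp, ← integral_const_mul]
  refine integral_mono ((hZint.sub hTint).const_mul _) (hTexp.sub hXexp) fun x => ?_
  dsimp only
  set U := ‖T x - θ1‖ ^ 2 / (2 * γ) with hU
  set V := ‖x.1 - θ1‖ ^ 2 / (2 * γ) with hV
  have hconv : Real.exp (-V) * (V - U) ≤ Real.exp (-U) - Real.exp (-V) := by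
    have hfac : Real.exp (-U) = Real.exp (-V) * Real.exp (V - U) := by
      rw [← Real.exp_add]; ring_nf
    rw [hfac]
    nlinarith [Real.add_one_le_exp (V - U), Real.exp_pos (-V)]
  have hlow := mul_le_mul_of_nonneg_right hconv (jointDens_nonneg p h1 h2 θ1 θ2 x)
  have heq : Real.exp (-V) * (V - U) * jointDens p v1 v2 θ1 θ2 x =
      D / (2 * γ) * (‖x.1 - θ1‖ ^ 2 * jointDens p (γ * v1 / (γ + v1)) v2 θ1 θ2 x -
        ‖T x - θ1‖ ^ 2 * jointDens p (γ * v1 / (γ + v1)) v2 θ1 θ2 x) := by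
    rw [mul_right_comm, hV, hDeq, hU]
    field_simp
  linarith

/-- The α-divergence risk of a Gaussian plug-in density is an affine function of the expected
Gaussian kernel loss of the plugged-in estimator. -/
lemma exists_aRisk_gdens_eq (p : ℕ) {α v1 v2 σY2 c : ℝ} (hα : |α| < 1) (h1 : 0 < v1)
    (h2 : 0 < v2) (hσY : 0 < σY2) (hc : 0 < c) :
    ∃ k L : ℝ, 0 < L ∧ ∀ (θ1 θ2 : Ep p) (T : Ep p × Ep p → Ep p), Measurable T →
      aRisk p α v1 v2 σY2 θ1 θ2 (fun x y => gdens p (c * σY2) (y - T x)) =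
        k * (∫ x, jointDens p v1 v2 θ1 θ2 x) -
          L * ∫ x, Real.exp (-(‖T x - θ1‖ ^ 2 /
            (2 * (2 * σY2 * (c / (1 + α) + 1 / (1 - α)))))) * jointDens p v1 v2 θ1 θ2 x := by
  obtain ⟨hα1, hα2⟩ := abs_lt.mp hα
  have hp : 0 < 1 + α := by linarith
  have hm : 0 < 1 - α := by linarith
  have hsq : 0 < 1 - α ^ 2 := by nlinarith
  obtain ⟨K, hK, hKeq⟩ := exists_integral_gdens_rpow_mul_gdens_rpow p (v := c * σY2) (w := σY2)
    (s := (1 + α) / 2) (r := (1 - α) / 2) (by positivity) hσY (by positivity) (by positivity)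
  have hγ : c * σY2 / ((1 + α) / 2) + σY2 / ((1 - α) / 2) =
      2 * σY2 * (c / (1 + α) + 1 / (1 - α)) := by
    field_simp
  refine ⟨4 / (1 - α ^ 2), 4 / (1 - α ^ 2) * K, by positivity, fun θ1 θ2 T hT => ?_⟩
  rw [hγ] at hKeq
  unfold aRisk
  simp_rw [hKeq]
  rw [← integral_const_mul, ← integral_const_mul, ← integral_sub
    ((integrable_jointDens p h1 h2 θ1 θ2).const_mul _)
    ((integrable_exp_neg_mul_jointDens p h1 h2 (by positivity) θ1 θ2 hT).const_mul _)]
  congr 1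
  ext x
  ring

/-- If `θ̂(Z)` dominates `Z1` in squared-error risk over `{θ : θ1 - θ2 ∈ A}` in the
shrunken-variance model `Z1 ~ N_p(θ1, σ_{Z1}² I)` with
`σ_{Z1}² = γσ1²/(γ+σ1²)`, `γ = 2σY²(c/(1+α)+1/(1−α))`, then the predictive density
`N_p(θ̂(X), cσY² I)` dominates `N_p(X1, cσY² I)` in α-divergence risk over the same
restricted parameter space. -/
theorem stmt9 (p : ℕ) (α : ℝ) (hα : |α| < 1)
    (σ12 σ22 σY2 : ℝ) (hσ1 : 0 < σ12) (hσ2 : 0 < σ22) (hσY : 0 < σY2)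
    (c : ℝ) (hc : 0 < c)
    (γ : ℝ) (hγ : γ = 2 * σY2 * (c / (1 + α) + 1 / (1 - α)))
    (σZ12 : ℝ) (hσZ : σZ12 = γ * σ12 / (γ + σ12))
    (A : Set (Ep p)) (hA : MeasurableSet A)
    (θhat : Ep p × Ep p → Ep p) (hmeas : Measurable θhat)
    (hint : ∀ θ1 θ2 : Ep p, θ1 - θ2 ∈ A →
      Integrable (fun z : Ep p × Ep p =>
        ‖θhat z - θ1‖ ^ 2 * jointDens p σZ12 σ22 θ1 θ2 z))
    (hdom : ∀ θ1 θ2 : Ep p, θ1 - θ2 ∈ A →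
      (∫ z : Ep p × Ep p, ‖θhat z - θ1‖ ^ 2 * jointDens p σZ12 σ22 θ1 θ2 z) ≤
      (∫ z : Ep p × Ep p, ‖z.1 - θ1‖ ^ 2 * jointDens p σZ12 σ22 θ1 θ2 z))
    (hstrict : ∃ θ1 θ2 : Ep p, θ1 - θ2 ∈ A ∧
      (∫ z : Ep p × Ep p, ‖θhat z - θ1‖ ^ 2 * jointDens p σZ12 σ22 θ1 θ2 z) <
      (∫ z : Ep p × Ep p, ‖z.1 - θ1‖ ^ 2 * jointDens p σZ12 σ22 θ1 θ2 z)) :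
    (∀ θ1 θ2 : Ep p, θ1 - θ2 ∈ A →
      aRisk p α σ12 σ22 σY2 θ1 θ2 (fun x y => gdens p (c * σY2) (y - θhat x)) ≤
      aRisk p α σ12 σ22 σY2 θ1 θ2 (fun x y => gdens p (c * σY2) (y - x.1))) ∧
    (∃ θ1 θ2 : Ep p, θ1 - θ2 ∈ A ∧
      aRisk p α σ12 σ22 σY2 θ1 θ2 (fun x y => gdens p (c * σY2) (y - θhat x)) <
      aRisk p α σ12 σ22 σY2 θ1 θ2 (fun x y => gdens p (c * σY2) (y - x.1))) := by
  obtain ⟨hα1, hα2⟩ := abs_lt.mp hα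
  have hp : 0 < 1 + α := by linarith
  have hm : 0 < 1 - α := by linarith
  have hγpos : 0 < γ := by rw [hγ]; positivity
  obtain ⟨D, hD, hDle⟩ := exists_mul_sq_risk_sub_le p hσ1 hσ2 hγpos
  obtain ⟨k, L, hL, hrisk⟩ := exists_aRisk_gdens_eq p hα hσ1 hσ2 hσY hc
  rw [← hσZ] at hDle
  rw [← hγ] at hrisk
  have hkey : ∀ θ1 θ2 : Ep p, θ1 - θ2 ∈ A →
      L * (D * ((∫ z : Ep p × Ep p, ‖z.1 - θ1‖ ^ 2 * jointDens p σZ12 σ22 θ1 θ2 z) -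
        ∫ z : Ep p × Ep p, ‖θhat z - θ1‖ ^ 2 * jointDens p σZ12 σ22 θ1 θ2 z)) ≤
      aRisk p α σ12 σ22 σY2 θ1 θ2 (fun x y => gdens p (c * σY2) (y - x.1)) -
        aRisk p α σ12 σ22 σY2 θ1 θ2 (fun x y => gdens p (c * σY2) (y - θhat x)) := by
    intro θ1 θ2 hθ
    rw [hrisk θ1 θ2 θhat hmeas, hrisk θ1 θ2 Prod.fst measurable_fst]
    have h := mul_le_mul_of_nonneg_left (hDle θ1 θ2 θhat hmeas (hint θ1 θ2 hθ)) hL.le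
    linarith
  refine ⟨fun θ1 θ2 hθ => ?_, ?_⟩
  · have hnonneg := mul_nonneg hL.le (mul_nonneg hD.le (sub_nonneg.mpr (hdom θ1 θ2 hθ)))
    linarith [hkey θ1 θ2 hθ]
  · obtain ⟨θ1, θ2, hθ, hlt⟩ := hstrict
    have hpos := mul_pos hL (mul_pos hD (sub_pos.mpr hlt))
    exact ⟨θ1, θ2, hθ, by linarith [hkey θ1 θ2 hθ]⟩


end
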